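/- The subgroup of Ŝ consisting of the elements that fix both constant sequences, i.e. {g ∈ Ŝ : 0^∞·g = 0^∞ and 1^∞·g = 1^∞}, equals the Lodha–Moore group _yG_y. -/

import Mathlib

/-- The Cantor set of infinite binary sequences. -/
abbrev Cantor : Type := ℕ → Bool

/-- Concatenation of a finite binary sequence with an infinite binary sequence. -/
def cat (s : List Bool) (η : Cantor) : Cantor :=
  fun n => if h : n < s.length then s.get ⟨n, h⟩ else η (n - s.length)

/-- `s` is a (finite) prefix of the infinite sequence `ξ`. -/
def IsPrefixOf (s : List Bool) (ξ : Cantor) : Prop := ∃ η : Cantor, ξ = cat s η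

/-- The group of self-homeomorphisms of a topological space, with
`(f * g) ξ = f (g ξ)` (i.e. in the right-action convention `ξ·(g h) = (ξ·g)·h`,
the product `g * f` corresponds to the word "apply `f`, then `g`"). -/
instance {α : Type*} [TopologicalSpace α] : Group (α ≃ₜ α) where
  mul f g := g.trans f
  one := Homeomorph.refl α
  inv := Homeomorph.symm
  mul_assoc _ _ _ := Homeomorph.ext fun _ => rfl
  one_mul _ := Homeomorph.ext fun _ => rfl
  mul_one _ := Homeomorph.ext fun _ => rfl
  inv_mul_cancel f := Homeomorph.ext fun ξ => f.symm_apply_apply ξ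

@[simp] lemma homeo_mul_apply {α : Type*} [TopologicalSpace α] (f g : α ≃ₜ α) (ξ : α) :
    (f * g) ξ = f (g ξ) := rfl

@[simp] lemma homeo_one_apply {α : Type*} [TopologicalSpace α] (ξ : α) :
    (1 : α ≃ₜ α) ξ = ξ := rfl

@[simp] lemma homeo_inv_apply {α : Type*} [TopologicalSpace α] (f : α ≃ₜ α) (ξ : α) :
    (f⁻¹ : α ≃ₜ α) ξ = f.symm ξ := rfl

/-- The data of the basic homeomorphisms `x`, `y`, `x_s`, `y_s`, `p_n` of the Cantor
set, together with their recursive defining equations. -/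
structure LMData where
  x : Cantor ≃ₜ Cantor
  y : Cantor ≃ₜ Cantor
  xx : List Bool → Cantor ≃ₜ Cantor
  yy : List Bool → Cantor ≃ₜ Cantor
  p : ℕ → Cantor ≃ₜ Cantor
  hx00 : ∀ η, x (cat [false, false] η) = cat [false] η
  hx01 : ∀ η, x (cat [false, true] η) = cat [true, false] η
  hx1 : ∀ η, x (cat [true] η) = cat [true, true] η
  hy00 : ∀ η, y (cat [false, false] η) = cat [false] (y η)
  hy01 : ∀ η, y (cat [false, true] η) = cat [true, false] (y.symm η)
  hy1 : ∀ η, y (cat [true] η) = cat [true, true] (y η)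
  hxx : ∀ s η, xx s (cat s η) = cat s (x η)
  hxx' : ∀ s ξ, ¬ IsPrefixOf s ξ → xx s ξ = ξ
  hyy : ∀ s η, yy s (cat s η) = cat s (y η)
  hyy' : ∀ s ξ, ¬ IsPrefixOf s ξ → yy s ξ = ξ
  hp1 : ∀ n k η, k < n → p n (cat (List.replicate k true ++ [false]) η) =
      cat (List.replicate (k + 1) true ++ [false]) η
  hp2 : ∀ n η, p n (cat (List.replicate n true ++ [false]) η) =
      cat (List.replicate (n + 1) true) η
  hp3 : ∀ n η, p n (cat (List.replicate (n + 1) true) η) = cat [false] η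

/-- Thompson's group `T`, generated by all `x_s` and all `p_n`. -/
def Tgrp (D : LMData) : Subgroup (Cantor ≃ₜ Cantor) :=
  Subgroup.closure (Set.range D.xx ∪ Set.range D.p)

/-- The group `Ŝ`, generated by all `x_s`, all `y_s` and all `p_n`. -/
def Shat (D : LMData) : Subgroup (Cantor ≃ₜ Cantor) :=
  Subgroup.closure (Set.range D.xx ∪ Set.range D.yy ∪ Set.range D.p)

/-- The homeomorphism `y₁₀ y₁₁₀⁻¹` (right-action word: first `y₁₀`, then `y₁₁₀⁻¹`). -/
def sgen (D : LMData) : Cantor ≃ₜ Cantor :=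
  (D.yy [true, true, false])⁻¹ * D.yy [true, false]

/-- The group `S`, generated by Thompson's group `T` together with `y₁₀ y₁₁₀⁻¹`. -/
def Sgrp (D : LMData) : Subgroup (Cantor ≃ₜ Cantor) :=
  Subgroup.closure (↑(Tgrp D) ∪ {sgen D})

/-- The Lodha–Moore group `_yG_y`, generated by all `x_s` and all `y_s`. -/
def LMgrp (D : LMData) : Subgroup (Cantor ≃ₜ Cantor) :=
  Subgroup.closure (Set.range D.xx ∪ Set.range D.yy)

namespace LodhaMoore

open List

/-! ### Concatenation of words and sequences -/

@[simp] lemma cat_nil (η : Cantor) : cat [] η = η := by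
  funext n; simp [cat]

@[simp] lemma cat_cons_zero (a : Bool) (s : List Bool) (η : Cantor) : cat (a :: s) η 0 = a := by
  simp [cat]

@[simp] lemma cat_cons_succ (a : Bool) (s : List Bool) (η : Cantor) (n : ℕ) :
    cat (a :: s) η (n + 1) = cat s η n := by
  simp [cat]

lemma cat_cons (a : Bool) (s : List Bool) (η : Cantor) : cat (a :: s) η = cat [a] (cat s η) := by
  funext n; cases n <;> simp

lemma cat_append (s t : List Bool) (η : Cantor) : cat (s ++ t) η = cat s (cat t η) := by
  induction s with
  | nil => simp
  | cons a s ih => rw [cons_append, cat_cons, ih, ← cat_cons]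

lemma cat_cons_inj {a b : Bool} {s t : List Bool} {η ζ : Cantor} :
    cat (a :: s) η = cat (b :: t) ζ ↔ a = b ∧ cat s η = cat t ζ := by
  refine ⟨fun h => ⟨by simpa using congrFun h 0, funext fun n => ?_⟩, fun ⟨h, h'⟩ => ?_⟩
  · simpa using congrFun h (n + 1)
  · rw [cat_cons, h, h', ← cat_cons]

@[simp] lemma cat_inj {s : List Bool} {η ζ : Cantor} : cat s η = cat s ζ ↔ η = ζ := by
  induction s with
  | nil => simp
  | cons a s ih => simp [cat_cons_inj, ih]

lemma exists_eq_cat_singleton (ξ : Cantor) : ∃ a η, ξ = cat [a] η :=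
  ⟨ξ 0, fun n => ξ (n + 1), by funext n; cases n <;> simp⟩

/-- The constant sequence. -/
def const (b : Bool) : Cantor := fun _ => b

lemma cat_const (b : Bool) : cat [b] (const b) = const b := by
  funext n; cases n <;> simp [const]

lemma cat_eq_const {b : Bool} {s : List Bool} {η : Cantor} :
    cat s η = const b ↔ (∀ a ∈ s, a = b) ∧ η = const b := by
  induction s with
  | nil => simp
  | cons a s ih => rw [← cat_const b, cat_cons_inj, cat_nil, ih, cat_const]; simp [and_assoc]

lemma exists_eq_cat_of_cat_eq {b : Bool} {s w : List Bool} {η : Cantor}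
    (h : cat s η = cat w (const b)) : ∃ v, η = cat v (const b) := by
  induction s generalizing w with
  | nil => exact ⟨w, by simpa using h⟩
  | cons a s ih =>
    cases w with
    | nil =>
      rw [← cat_const b, cat_nil, cat_cons_inj] at h
      exact ih (w := []) (by simpa using h.2)
    | cons c w => exact ih (cat_cons_inj.1 h).2

/-! ### Canonical maps between cones -/

/-- `g` maps the cone of `u` canonically onto the cone of `v`. -/
def Carries (g : Cantor ≃ₜ Cantor) (u v : List Bool) : Prop := ∀ η, g (cat u η) = cat v η

lemma Carries.append {g : Cantor ≃ₜ Cantor} {u v : List Bool} (h : Carries g u v)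
    (w : List Bool) : Carries g (u ++ w) (v ++ w) := fun η => by
  rw [cat_append, cat_append, h]

lemma Carries.inv {g : Cantor ≃ₜ Cantor} {u v : List Bool} (h : Carries g u v) :
    Carries g⁻¹ v u := fun η => by
  rw [homeo_inv_apply, ← h, Homeomorph.symm_apply_apply]

lemma Carries.mul {g h : Cantor ≃ₜ Cantor} {u v w : List Bool} (hg : Carries g v w)
    (hh : Carries h u v) : Carries (g * h) u w := fun η => by
  rw [homeo_mul_apply, hh, hg]

/-- `g` maps the cones of the first list canonically onto those of the second, in order. -/
abbrev CarriesList (g : Cantor ≃ₜ Cantor) : List (List Bool) → List (List Bool) → Prop :=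
  Forall₂ (Carries g)

lemma CarriesList.inv {g : Cantor ≃ₜ Cantor} {L M : List (List Bool)} (h : CarriesList g L M) :
    CarriesList g⁻¹ M L :=
  Forall₂.flip (h.imp fun _ _ h => h.inv)

lemma CarriesList.mul {g h : Cantor ≃ₜ Cantor} {L M N : List (List Bool)}
    (hg : CarriesList g M N) (hh : CarriesList h L M) : CarriesList (g * h) L N := by
  induction hh generalizing N with
  | nil => cases hg; exact .nil
  | cons h₁ _ ih => cases hg with | cons h₂ h₃ => exact .cons (h₂.mul h₁) (ih h₃)

lemma CarriesList.append {g : Cantor ≃ₜ Cantor} {L L' M M' : List (List Bool)}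
    (h : CarriesList g L M) (h' : CarriesList g L' M') : CarriesList g (L ++ L') (M ++ M') :=
  rel_append h h'

lemma CarriesList.rotate {g : Cantor ≃ₜ Cantor} {L M : List (List Bool)}
    (h : CarriesList g L M) (k : ℕ) : CarriesList g (L.rotate k) (M.rotate k) := by
  rw [rotate_eq_drop_append_take_mod, rotate_eq_drop_append_take_mod, h.length_eq]
  exact CarriesList.append (forall₂_drop _ h) (forall₂_take _ h)

lemma carriesList_one (L : List (List Bool)) : CarriesList 1 L L :=
  forall₂_same.2 fun _ _ _ => rfl

lemma CarriesList.exists_of_mem {g : Cantor ≃ₜ Cantor} {L M : List (List Bool)}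
    (h : CarriesList g L M) {v : List Bool} (hv : v ∈ M) : ∃ u ∈ L, Carries g u v := by
  induction h with
  | nil => simp at hv
  | cons h₁ _ ih =>
    rcases mem_cons.1 hv with rfl | hv
    · exact ⟨_, mem_cons_self, h₁⟩
    · obtain ⟨u, hu, huv⟩ := ih hv
      exact ⟨u, mem_cons_of_mem _ hu, huv⟩

/-! ### Binary trees and their leaves -/

/-- Finite rooted binary trees. -/
inductive BTree
  | leaf : BTree
  | node : BTree → BTree → BTree

namespace BTree

/-- The leaves of a binary tree, from left to right, as finite words. -/
def leaves : BTree → List (List Bool)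
  | leaf => [[]]
  | node l r => l.leaves.map (cons false) ++ r.leaves.map (cons true)

lemma exists_leaves_eq_cons (A : BTree) :
    ∃ z Z, A.leaves = z :: Z ∧ cat z (const false) = const false := by
  induction A with
  | leaf => exact ⟨[], [], rfl, cat_nil _⟩
  | node l r ihl _ =>
    obtain ⟨z, Z, h, hz⟩ := ihl
    exact ⟨false :: z, Z.map (cons false) ++ r.leaves.map (cons true), by simp [leaves, h],
      by rw [cat_cons, hz, cat_const]⟩

lemma exists_mem_leaves_eq_cat (A : BTree) (ξ : Cantor) : ∃ u ∈ A.leaves, ∃ η, ξ = cat u η := by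
  induction A generalizing ξ with
  | leaf => exact ⟨[], by simp [leaves], ξ, (cat_nil ξ).symm⟩
  | node l r ihl ihr =>
    obtain ⟨a, ζ, rfl⟩ := exists_eq_cat_singleton ξ
    cases a with
    | false =>
      obtain ⟨u, hu, η, rfl⟩ := ihl ζ
      exact ⟨false :: u, by simp [leaves, hu], η, (cat_cons _ _ _).symm⟩
    | true =>
      obtain ⟨u, hu, η, rfl⟩ := ihr ζ
      exact ⟨true :: u, by simp [leaves, hu], η, (cat_cons _ _ _).symm⟩

lemma eq_nil_of_leaves_eq_append {A : BTree} {X Y : List (List Bool)} {l : List Bool}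
    (h : A.leaves = X ++ l :: Y) (hl : ∀ a ∈ l, a = false) : X = [] := by
  induction A generalizing X Y l with
  | leaf =>
    rcases X with _ | ⟨_, _⟩
    · rfl
    · simp [leaves] at h
  | node a b iha _ =>
    have key : l ∉ b.leaves.map (cons true) := fun hm => by
      obtain ⟨v, _, rfl⟩ := mem_map.1 hm
      simpa using hl true mem_cons_self
    rcases append_eq_append_iff.1 h with ⟨c, -, h₂⟩ | ⟨c, h₁, h₂⟩
    · exact absurd (h₂ ▸ by simp) key
    · rcases c with _ | ⟨m, c⟩
      · rw [nil_append] at h₂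
        exact absurd (h₂ ▸ mem_cons_self) key
      · obtain ⟨rfl, rfl⟩ := cons_eq_cons.1 h₂
        obtain ⟨X', Y', h₃, rfl, h₄⟩ := map_eq_append_iff.1 h₁
        obtain ⟨l', c', rfl, rfl, rfl⟩ := map_eq_cons_iff.1 h₄
        rw [iha h₃ fun a ha => hl a (mem_cons_of_mem _ ha), map_nil]

lemma exists_mem_leaves (s : List Bool) : ∃ A : BTree, s ∈ A.leaves := by
  induction s with
  | nil => exact ⟨leaf, by simp [leaves]⟩
  | cons a s ih =>
    obtain ⟨A, hA⟩ := ih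
    cases a with
    | false => exact ⟨node A leaf, by simp [leaves, hA]⟩
    | true => exact ⟨node leaf A, by simp [leaves, hA]⟩

end BTree

open BTree

lemma CarriesList.eq_of_leaves {g h : Cantor ≃ₜ Cantor} {A : BTree} {M : List (List Bool)}
    (hg : CarriesList g A.leaves M) (hh : CarriesList h A.leaves M) : g = h := by
  refine Homeomorph.ext fun ξ => ?_
  obtain ⟨u, hu, η, rfl⟩ := A.exists_mem_leaves_eq_cat ξ
  have := forall₂_same.1 (hh.inv.mul hg) u hu η
  rw [homeo_mul_apply, homeo_inv_apply, Homeomorph.symm_apply_eq] at this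
  exact this

/-! ### Expansions -/

/-- Replace each word of a list by its extensions by the leaves of the corresponding tree. -/
def expand : List (List Bool) → List BTree → List (List Bool)
  | u :: L, t :: Ts => t.leaves.map (u ++ ·) ++ expand L Ts
  | _, _ => []

@[simp] lemma expand_nil_left (Ts : List BTree) : expand [] Ts = [] := by
  cases Ts <;> rfl

lemma expand_append {L L' : List (List Bool)} {Ts Ts' : List BTree} (h : L.length = Ts.length) :
    expand (L ++ L') (Ts ++ Ts') = expand L Ts ++ expand L' Ts' := by
  induction L generalizing Ts with
  | nil => cases Ts with
    | nil => simp
    | cons _ _ => simp at h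
  | cons u L ih => cases Ts with
    | nil => simp at h
    | cons t Ts => simp [expand, ih (Nat.succ.inj h)]

lemma expand_map_cons (b : Bool) (L : List (List Bool)) (Ts : List BTree) :
    expand (L.map (cons b)) Ts = (expand L Ts).map (cons b) := by
  induction L generalizing Ts with
  | nil => simp
  | cons u L ih => cases Ts with
    | nil => simp [expand]
    | cons t Ts => simp [expand, ih]

lemma expand_replicate_leaf (L : List (List Bool)) : expand L (replicate L.length leaf) = L := by
  induction L with
  | nil => simp
  | cons u L ih => simp [expand, replicate_succ, leaves, ih]

lemma expand_leaves_leaf (A : BTree) : expand leaf.leaves [A] = A.leaves := by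
  simp [leaves, expand]

lemma CarriesList.expand {g : Cantor ≃ₜ Cantor} {L M : List (List Bool)}
    (h : CarriesList g L M) (Ts : List BTree) :
    CarriesList g (expand L Ts) (expand M Ts) := by
  induction h generalizing Ts with
  | nil => simp
  | cons h₁ _ ih => cases Ts with
    | nil => simp [LodhaMoore.expand]
    | cons t Ts =>
      refine CarriesList.append ?_ (ih Ts)
      rw [CarriesList, forall₂_map_left_iff, forall₂_map_right_iff]
      exact forall₂_same.2 fun w _ => h₁.append w

lemma exists_leaves_eq_expand (A : BTree) {Ts : List BTree} (h : A.leaves.length = Ts.length) :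
    ∃ U : BTree, U.leaves = expand A.leaves Ts := by
  induction A generalizing Ts with
  | leaf =>
    obtain ⟨t, rfl⟩ := length_eq_one_iff.1 h.symm
    exact ⟨t, (expand_leaves_leaf t).symm⟩
  | node l r ihl ihr =>
    have hlen : l.leaves.length + r.leaves.length = Ts.length := by simpa [leaves] using h
    have h₁ : l.leaves.length = (Ts.take l.leaves.length).length := by simp; omega
    obtain ⟨U, hU⟩ := ihl h₁
    obtain ⟨V, hV⟩ := ihr (Ts := Ts.drop l.leaves.length) (by simp; omega)
    refine ⟨node U V, ?_⟩
    rw [leaves, hU, hV, leaves]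
    conv_rhs => rw [← take_append_drop l.leaves.length Ts]
    rw [expand_append (by simpa using h₁), expand_map_cons, expand_map_cons]

lemma exists_isRotated_expand {A : BTree} {L : List (List Bool)} (hL : L ~r A.leaves)
    {Ts : List BTree} (h : L.length = Ts.length) : ∃ U : BTree, expand L Ts ~r U.leaves := by
  obtain ⟨k, hk⟩ := hL
  rw [rotate_eq_drop_append_take_mod] at hk
  set j := k % L.length
  obtain ⟨U, hU⟩ := exists_leaves_eq_expand A (Ts := Ts.drop j ++ Ts.take j)
    (by rw [← hk]; simp [h])
  refine ⟨U, ?_⟩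
  rw [hU, ← hk, expand_append (by simp [h])]
  conv_lhs => rw [← take_append_drop j L, ← take_append_drop j Ts]
  rw [expand_append (by simp [h])]
  exact isRotated_append

lemma exists_expand_eq_expand (A B : BTree) : ∃ Ts Ts' : List BTree,
    A.leaves.length = Ts.length ∧ B.leaves.length = Ts'.length ∧
      expand A.leaves Ts = expand B.leaves Ts' := by
  induction A generalizing B with
  | leaf =>
    exact ⟨[B], replicate B.leaves.length leaf, by simp [leaves], by simp, by
      rw [expand_replicate_leaf, expand_leaves_leaf]⟩
  | node l r ihl ihr =>
    cases B with
    | leaf =>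
      exact ⟨replicate (node l r).leaves.length leaf, [node l r], by simp, by simp [leaves], by
        rw [expand_replicate_leaf, expand_leaves_leaf]⟩
    | node l' r' =>
      obtain ⟨T₁, T₁', h₁, h₁', e₁⟩ := ihl l'
      obtain ⟨T₂, T₂', h₂, h₂', e₂⟩ := ihr r'
      refine ⟨T₁ ++ T₂, T₁' ++ T₂', by simp [leaves, *], by simp [leaves, *], ?_⟩
      rw [leaves, leaves, expand_append (by simpa using h₁), expand_append (by simpa using h₁')]
      simp only [expand_map_cons, e₁, e₂]

/-! ### Rotational tree maps -/

/-- `g` maps the leaves of some tree canonically onto those of another, up to rotation; these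
homeomorphisms form Thompson's group `T`. -/
def IsTreeRotation (g : Cantor ≃ₜ Cantor) : Prop :=
  ∃ (A B : BTree) (L M : List (List Bool)),
    L ~r A.leaves ∧ M ~r B.leaves ∧ CarriesList g L M

namespace IsTreeRotation

variable {g h : Cantor ≃ₜ Cantor}

lemma of_carriesList {A B : BTree} (hg : CarriesList g A.leaves B.leaves) : IsTreeRotation g :=
  ⟨A, B, _, _, .refl _, .refl _, hg⟩

protected lemma one : IsTreeRotation 1 := of_carriesList (carriesList_one leaf.leaves)

protected lemma inv (hg : IsTreeRotation g) : IsTreeRotation g⁻¹ := by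
  obtain ⟨A, B, L, M, hL, hM, hg⟩ := hg
  exact ⟨B, A, M, L, hM, hL, hg.inv⟩

lemma exists_leaves_left (hg : IsTreeRotation g) : ∃ (A B : BTree) (M : List (List Bool)),
    M ~r B.leaves ∧ CarriesList g A.leaves M := by
  obtain ⟨A, B, L, M, ⟨k, hk⟩, hM, hg⟩ := hg
  exact ⟨A, B, M.rotate k, (IsRotated.forall M k).trans hM, hk ▸ hg.rotate k⟩

protected lemma mul (hg : IsTreeRotation g) (hh : IsTreeRotation h) : IsTreeRotation (g * h) := by
  obtain ⟨A, B, M, hM, hg⟩ := hg.exists_leaves_left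
  obtain ⟨A', B', M', hM', hh⟩ := hh.inv.exists_leaves_left
  obtain ⟨Ts, Ts', hT, hT', e⟩ := exists_expand_eq_expand A A'
  obtain ⟨U, hU⟩ := exists_isRotated_expand hM (hg.length_eq.symm.trans hT)
  obtain ⟨U', hU'⟩ := exists_isRotated_expand hM' (hh.length_eq.symm.trans hT')
  refine ⟨U', U, _, _, hU', hU, (hg.expand Ts).mul ?_⟩
  rw [e]
  simpa using (hh.expand Ts').inv

lemma exists_apply_const_eq (hg : IsTreeRotation g) :
    ∃ w, g (const false) = cat w (const false) := by
  obtain ⟨A, B, M, -, hg⟩ := hg.exists_leaves_left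
  obtain ⟨z, Z, hA, hz⟩ := A.exists_leaves_eq_cons
  rw [hA] at hg
  obtain ⟨w, W, hw, -⟩ := forall₂_cons_left_iff.1 hg
  exact ⟨w, by rw [← hw, hz]⟩

lemma exists_carriesList_of_fix (hg : IsTreeRotation g) (h₀ : g (const false) = const false) :
    ∃ A B : BTree, CarriesList g A.leaves B.leaves := by
  obtain ⟨A, B, M, ⟨k, hk⟩, hg⟩ := hg.exists_leaves_left
  refine ⟨A, B, ?_⟩
  suffices M = B.leaves from this ▸ hg
  obtain ⟨z, Z, hA, hz⟩ := A.exists_leaves_eq_cons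
  rw [hA] at hg
  obtain ⟨l, M', hl, -, rfl⟩ := forall₂_cons_left_iff.1 hg
  have hl₀ : cat l (const false) = const false := by rw [← hl, hz, h₀]
  rw [rotate_eq_drop_append_take_mod] at hk
  rcases Nat.eq_zero_or_pos (k % (l :: M').length) with h | h
  · rwa [h, take_zero, drop_zero, append_nil] at hk
  · obtain ⟨j, hj⟩ := Nat.exists_eq_succ_of_ne_zero h.ne'
    rw [hj, take_succ_cons, drop_succ_cons] at hk
    have hd := eq_nil_of_leaves_eq_append hk.symm (cat_eq_const.1 hl₀).1
    rw [hd, nil_append] at hk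
    rw [← hk]
    conv_lhs => rw [← take_append_drop j M', hd, append_nil]

end IsTreeRotation

/-! ### The generators -/

section Generators

variable (D : LMData)

/-- The right comb with `n` carets. -/
def comb : ℕ → BTree
  | 0 => leaf
  | n + 1 => node leaf (comb n)

lemma length_leaves_comb (n : ℕ) : (comb n).leaves.length = n + 1 := by
  induction n with
  | zero => rfl
  | succ n ih => simp [comb, leaves, ih]

lemma xx_cons_apply (b : Bool) (s : List Bool) (η : Cantor) :
    D.xx (b :: s) (cat [b] η) = cat [b] (D.xx s η) := by
  by_cases h : IsPrefixOf s η
  · obtain ⟨ζ, rfl⟩ := h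
    rw [D.hxx, ← cat_cons, D.hxx, cat_cons]
  · rw [D.hxx' _ _ h, D.hxx']
    rintro ⟨ζ, hζ⟩
    exact h ⟨ζ, by simpa [cat_cons_inj] using hζ⟩

lemma xx_cons_apply_of_ne {b c : Bool} (hbc : c ≠ b) (s : List Bool) (η : Cantor) :
    D.xx (b :: s) (cat [c] η) = cat [c] η := by
  apply D.hxx'
  rintro ⟨ζ, hζ⟩
  exact hbc (cat_cons_inj.1 hζ).1

/-- Thompson's group `F`. -/
def Fgrp : Subgroup (Cantor ≃ₜ Cantor) := Subgroup.closure (Set.range D.xx)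

lemma Fgrp_le_LMgrp : Fgrp D ≤ LMgrp D := Subgroup.closure_mono Set.subset_union_left

variable {D}

lemma exists_shift_mem_Fgrp (b : Bool) {f : Cantor ≃ₜ Cantor} (hf : f ∈ Fgrp D) :
    ∃ f' ∈ Fgrp D, (∀ η, f' (cat [b] η) = cat [b] (f η)) ∧
      ∀ c ≠ b, ∀ η, f' (cat [c] η) = cat [c] η := by
  induction hf using Subgroup.closure_induction with
  | mem f hf =>
    obtain ⟨s, rfl⟩ := hf
    exact ⟨D.xx (b :: s), Subgroup.subset_closure ⟨_, rfl⟩, xx_cons_apply D b s,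
      fun c hc => xx_cons_apply_of_ne D hc s⟩
  | one => exact ⟨1, one_mem _, fun _ => rfl, fun _ _ _ => rfl⟩
  | mul f g _ _ ihf ihg =>
    obtain ⟨f', hf, hf₁, hf₂⟩ := ihf
    obtain ⟨g', hg, hg₁, hg₂⟩ := ihg
    exact ⟨f' * g', mul_mem hf hg, fun η => by simp [hf₁, hg₁],
      fun c hc η => by simp [hf₂ c hc, hg₂ c hc]⟩
  | inv f _ ih =>
    obtain ⟨f', hf, hf₁, hf₂⟩ := ih
    exact ⟨f'⁻¹, inv_mem hf, fun η => by simp [Homeomorph.symm_apply_eq, hf₁],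
      fun c hc η => by simp [Homeomorph.symm_apply_eq, hf₂ c hc]⟩

variable (D) in
/-- Some element of `F` maps the leaves of `A` canonically onto those of `B`, in order. -/
def FRel (A B : BTree) : Prop := ∃ f ∈ Fgrp D, CarriesList f A.leaves B.leaves

lemma FRel.refl (A : BTree) : FRel D A A := ⟨1, one_mem _, carriesList_one _⟩

lemma FRel.trans {A B C : BTree} (h : FRel D A B) (h' : FRel D B C) : FRel D A C := by
  obtain ⟨f, hf, hAB⟩ := h
  obtain ⟨g, hg, hBC⟩ := h'
  exact ⟨g * f, mul_mem hg hf, hBC.mul hAB⟩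

lemma carriesList_map_cons {f f' : Cantor ≃ₜ Cantor} {b : Bool}
    (hf : ∀ η, f' (cat [b] η) = cat [b] (f η)) {L M : List (List Bool)}
    (h : CarriesList f L M) : CarriesList f' (L.map (cons b)) (M.map (cons b)) := by
  rw [CarriesList, forall₂_map_left_iff, forall₂_map_right_iff]
  exact h.imp fun u v huv η => by rw [cat_cons, hf, huv, ← cat_cons]

lemma FRel.node_left {A B : BTree} (h : FRel D A B) (C : BTree) :
    FRel D (node A C) (node B C) := by
  obtain ⟨f, hf, hAB⟩ := h
  obtain ⟨f', hf', h₁, h₂⟩ := exists_shift_mem_Fgrp false hf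
  exact ⟨f', hf', (carriesList_map_cons h₁ hAB).append
    (carriesList_map_cons (f := 1) (h₂ true (by simp)) (carriesList_one _))⟩

lemma FRel.node_right {A B : BTree} (h : FRel D A B) (C : BTree) :
    FRel D (node C A) (node C B) := by
  obtain ⟨f, hf, hAB⟩ := h
  obtain ⟨f', hf', h₁, h₂⟩ := exists_shift_mem_Fgrp true hf
  exact ⟨f', hf', (carriesList_map_cons (f := 1) (h₂ false (by simp)) (carriesList_one _)).append
    (carriesList_map_cons h₁ hAB)⟩

lemma xx_nil : D.xx [] = D.x := Homeomorph.ext fun η => by simpa using D.hxx [] η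

lemma carriesList_x (A B C : BTree) :
    CarriesList D.x (node (node A B) C).leaves (node A (node B C)).leaves := by
  have key : ∀ (u v : List Bool) (L : List (List Bool)), Carries D.x u v →
      CarriesList D.x (L.map (u ++ ·)) (L.map (v ++ ·)) := fun u v L h => by
    rw [CarriesList, forall₂_map_left_iff, forall₂_map_right_iff]
    exact forall₂_same.2 fun w _ => h.append w
  have := ((key _ _ A.leaves D.hx00).append (key _ _ B.leaves D.hx01)).append
    (key _ _ C.leaves D.hx1)
  simpa [leaves, Function.comp_def] using this

lemma FRel.assoc (A B C : BTree) : FRel D (node (node A B) C) (node A (node B C)) :=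
  ⟨D.xx [], Subgroup.subset_closure ⟨_, rfl⟩, by rw [xx_nil]; exact carriesList_x A B C⟩

lemma exists_FRel_comb (A : BTree) : ∃ n, FRel D A (comb n) := by
  induction A with
  | leaf => exact ⟨0, .refl _⟩
  | node l r ihl ihr =>
    obtain ⟨m, hm⟩ := ihl
    obtain ⟨n, hn⟩ := ihr
    suffices ∀ m, ∃ k, FRel D (node (comb m) (comb n)) (comb k) by
      obtain ⟨k, hk⟩ := this m
      exact ⟨k, ((hm.node_left r).trans (hn.node_right _)).trans hk⟩
    intro m
    induction m with
    | zero => exact ⟨n + 1, .refl _⟩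
    | succ m ih =>
      obtain ⟨k, hk⟩ := ih
      exact ⟨k + 1, (FRel.assoc leaf (comb m) (comb n)).trans (hk.node_right leaf)⟩

lemma CarriesList.mem_Fgrp {g : Cantor ≃ₜ Cantor} {A B : BTree}
    (hg : CarriesList g A.leaves B.leaves) : g ∈ Fgrp D := by
  obtain ⟨m, f, hf, hA⟩ := exists_FRel_comb (D := D) A
  obtain ⟨n, f', hf', hB⟩ := exists_FRel_comb (D := D) B
  have hmn : m = n := by
    have h₁ := hA.length_eq
    have h₂ := hB.length_eq
    have h₃ := hg.length_eq
    rw [length_leaves_comb] at h₁ h₂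
    omega
  subst hmn
  rw [hg.eq_of_leaves (hB.inv.mul hA)]
  exact mul_mem (inv_mem hf') hf

lemma IsTreeRotation.mem_LMgrp {g : Cantor ≃ₜ Cantor} (hg : IsTreeRotation g)
    (h₀ : g (const false) = const false) : g ∈ LMgrp D := by
  obtain ⟨A, B, h⟩ := hg.exists_carriesList_of_fix h₀
  exact Fgrp_le_LMgrp D h.mem_Fgrp

lemma isTreeRotation_xx (s : List Bool) : IsTreeRotation (D.xx s) := by
  suffices ∃ A B : BTree, CarriesList (D.xx s) A.leaves B.leaves by
    obtain ⟨A, B, h⟩ := this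
    exact .of_carriesList h
  induction s with
  | nil => exact ⟨_, _, by rw [xx_nil]; exact carriesList_x leaf leaf leaf⟩
  | cons b s ih =>
    obtain ⟨A, B, h⟩ := ih
    have h₁ := carriesList_map_cons (xx_cons_apply D b s) h
    have h₂ : ∀ c ≠ b, CarriesList (D.xx (b :: s)) (leaf.leaves.map (cons c))
        (leaf.leaves.map (cons c)) := fun c hc =>
      carriesList_map_cons (f := 1) (xx_cons_apply_of_ne D hc s) (carriesList_one _)
    cases b with
    | false => exact ⟨node A leaf, node B leaf, h₁.append (h₂ true (by simp))⟩
    | true => exact ⟨node leaf A, node leaf B, (h₂ false (by simp)).append h₁⟩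

lemma carriesList_p_aux (n m j : ℕ) (h : j + m = n + 1) :
    CarriesList (D.p n) ((comb m).leaves.map (replicate j true ++ ·))
      (((comb m).leaves.map (replicate j true ++ ·)).tail ++ [[false]]) := by
  induction m generalizing j with
  | zero =>
    obtain rfl : j = n + 1 := h
    simpa [comb, leaves, Carries] using D.hp3 n
  | succ m ih =>
    have ih := ih (j + 1) (by omega)
    have e : (comb (m + 1)).leaves.map (replicate j true ++ ·) =
        (replicate j true ++ [false]) :: (comb m).leaves.map (replicate (j + 1) true ++ ·) := by
      simp [comb, leaves, Function.comp_def, replicate_succ']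
    rw [e, tail_cons]
    cases m with
    | zero =>
      obtain rfl : j = n := by omega
      exact .cons (by simpa [Carries] using D.hp2 j) (by simpa [comb, leaves] using ih)
    | succ m =>
      have e' : (comb (m + 1)).leaves.map (replicate (j + 1) true ++ ·) =
          (replicate (j + 1) true ++ [false]) ::
            (comb m).leaves.map (replicate (j + 2) true ++ ·) := by
        simp [comb, leaves, Function.comp_def, replicate_succ' (n := j + 1)]
      have hj : Carries (D.p n) (replicate j true ++ [false]) (replicate (j + 1) true ++ [false]) :=
        fun η => D.hp1 n j η (by omega)
      rw [e'] at ih ⊢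
      exact .cons hj ih

lemma carriesList_p (n : ℕ) :
    CarriesList (D.p n) (comb (n + 1)).leaves ((comb (n + 1)).leaves.rotate 1) := by
  simpa [comb, leaves, Function.comp_def] using carriesList_p_aux (D := D) n (n + 1) 0 (by omega)

lemma isTreeRotation_p (n : ℕ) : IsTreeRotation (D.p n) :=
  ⟨_, _, _, _, .refl _, IsRotated.forall _ 1, carriesList_p n⟩

lemma exists_carriesList_comb_rotate (D : LMData) (n k : ℕ) :
    ∃ r, CarriesList r (comb n).leaves ((comb n).leaves.rotate k) := by
  cases n with
  | zero => exact ⟨1, by simpa [comb, leaves] using carriesList_one [[]]⟩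
  | succ n =>
    induction k with
    | zero => exact ⟨1, by simpa using carriesList_one _⟩
    | succ k ih =>
      obtain ⟨r, hr⟩ := ih
      refine ⟨D.p n * r, CarriesList.mul ?_ hr⟩
      have := (carriesList_p (D := D) n).rotate k
      rwa [rotate_rotate, add_comm 1 k] at this

end Generators

/-! ### Conjugating `y_s` by a tree rotation -/

/-- `α` is not an interior point of the (cyclic) interval given by the cone of `s`. -/
def NotInterior (s : List Bool) (α : Cantor) : Prop :=
  ∀ η, α = cat s η → η = const false

lemma exists_leaves_of_notInterior (s w : List Bool)
    (h : NotInterior s (cat w (const false))) :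
    ∃ A : BTree, s ∈ A.leaves ∧ ∃ u ∈ A.leaves, cat u (const false) = cat w (const false) := by
  induction s generalizing w with
  | nil => exact ⟨leaf, by simp [leaves], [], by simp [leaves],
      by rw [h (cat w (const false)) (cat_nil _).symm, cat_nil]⟩
  | cons b s ih =>
    obtain ⟨c, w', hw⟩ : ∃ c w', cat w (const false) = cat (c :: w') (const false) := by
      cases w with
      | nil => exact ⟨false, [], by rw [cat_const, cat_nil]⟩
      | cons c w' => exact ⟨c, w', rfl⟩
    rw [hw] at h ⊢
    by_cases hbc : c = b
    · subst hbc
      obtain ⟨A, hs, u, hu, huw⟩ := ih w' fun η hη => h η (cat_cons_inj.2 ⟨rfl, hη⟩)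
      cases c with
      | false => exact ⟨node A leaf, by simp [leaves, hs], false :: u, by simp [leaves, hu],
          cat_cons_inj.2 ⟨rfl, huw⟩⟩
      | true => exact ⟨node leaf A, by simp [leaves, hs], true :: u, by simp [leaves, hu],
          cat_cons_inj.2 ⟨rfl, huw⟩⟩
    · obtain ⟨A, hA⟩ := exists_mem_leaves s
      obtain ⟨B, hB⟩ := exists_mem_leaves w'
      cases b with
      | false =>
        obtain rfl : c = true := by simpa using hbc
        exact ⟨node A B, by simp [leaves, hA], true :: w', by simp [leaves, hB], rfl⟩
      | true =>
        obtain rfl : c = false := by simpa using hbc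
        exact ⟨node B A, by simp [leaves, hA], false :: w', by simp [leaves, hB], rfl⟩

section Main

variable {D : LMData}

lemma exists_isTreeRotation_of_notInterior (D : LMData) (s w : List Bool)
    (h : NotInterior s (cat w (const false))) :
    ∃ τ, IsTreeRotation τ ∧ τ (const false) = cat w (const false) ∧ ∃ s', Carries τ s' s := by
  obtain ⟨A, hs, u, hu, huw⟩ := exists_leaves_of_notInterior s w h
  obtain ⟨X, Y, hXY⟩ := append_of_mem hu
  obtain ⟨n, f, -, hf⟩ := exists_FRel_comb (D := D) A
  obtain ⟨r, hr⟩ := exists_carriesList_comb_rotate D n X.length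
  have hτ := (hf.inv.rotate X.length).mul hr
  refine ⟨f⁻¹ * r, ⟨_, _, _, _, .refl _, IsRotated.forall _ _, hτ⟩, ?_,
    (hτ.exists_of_mem (mem_rotate.2 hs)).imp fun _ h => h.2⟩
  obtain ⟨z, Z, hZ, hz⟩ := (comb n).exists_leaves_eq_cons
  rw [hZ, hXY, rotate_append_length_eq, cons_append] at hτ
  rw [← huw, ← (forall₂_cons.1 hτ).1, hz]

lemma mul_yy_of_carries {τ : Cantor ≃ₜ Cantor} {s' s : List Bool} (h : Carries τ s' s) :
    τ * D.yy s' = D.yy s * τ := by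
  refine Homeomorph.ext fun ξ => ?_
  by_cases hξ : IsPrefixOf s' ξ
  · obtain ⟨η, rfl⟩ := hξ
    simp only [homeo_mul_apply, D.hyy, h _]
  · rw [homeo_mul_apply, homeo_mul_apply, D.hyy' _ _ hξ, D.hyy']
    rintro ⟨η, hη⟩
    rw [← h, τ.injective.eq_iff] at hη
    exact hξ ⟨η, hη⟩

lemma yy_mem_LMgrp (s : List Bool) : D.yy s ∈ LMgrp D :=
  Subgroup.subset_closure (.inr ⟨s, rfl⟩)

lemma conj_yy_mem_LMgrp {τ : Cantor ≃ₜ Cantor} (hτ : IsTreeRotation τ) {s : List Bool}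
    (h : NotInterior s (τ (const false))) : τ⁻¹ * D.yy s * τ ∈ LMgrp D := by
  obtain ⟨w, hw⟩ := hτ.exists_apply_const_eq
  rw [hw] at h
  obtain ⟨σ, hσ, hσw, s', hs'⟩ := exists_isTreeRotation_of_notInterior D s w h
  have hf : σ⁻¹ * τ ∈ LMgrp D := (hσ.inv.mul hτ).mem_LMgrp <| by
    rw [homeo_mul_apply, hw, ← hσw, homeo_inv_apply, Homeomorph.symm_apply_apply]
  have e : τ⁻¹ * D.yy s * τ = (σ⁻¹ * τ)⁻¹ * D.yy s' * (σ⁻¹ * τ) := by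
    have : D.yy s' = σ⁻¹ * (D.yy s * σ) := by rw [← mul_yy_of_carries hs']; group
    rw [this]; group
  rw [e]
  exact mul_mem (mul_mem (inv_mem hf) (yy_mem_LMgrp s')) hf

/-! ### The Lodha–Moore group fixes the constant sequences -/

lemma x_const (b : Bool) : D.x (const b) = const b := by
  cases b with
  | false =>
    have := D.hx00 (const false)
    rwa [cat_cons, cat_const, cat_const] at this
  | true =>
    have := D.hx1 (const true)
    rwa [cat_cons true [true], cat_const, cat_const] at this

lemma eq_const_of_eq_cat {b : Bool} {ξ : Cantor} {s : List Bool} (hs : s ≠ [])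
    (hb : ∀ a ∈ s, a = b) (h : ξ = cat s ξ) : ξ = const b := by
  funext n
  induction n using Nat.strong_induction_on with
  | _ n ih =>
    rw [h]
    have hpos : 0 < s.length := length_pos_iff.2 hs
    unfold cat
    split_ifs with hn
    · exact hb _ (get_mem _ _)
    · exact ih _ (by omega)

lemma y_const (b : Bool) : D.y (const b) = const b := by
  cases b with
  | false =>
    have := D.hy00 (const false)
    rw [cat_cons, cat_const, cat_const] at this
    exact eq_const_of_eq_cat (by simp) (by simp) this
  | true =>
    have := D.hy1 (const true)
    rw [cat_const] at this
    exact eq_const_of_eq_cat (by simp) (by simp) this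

lemma LMgrp_apply_const {g : Cantor ≃ₜ Cantor} (hg : g ∈ LMgrp D) (b : Bool) :
    g (const b) = const b := by
  induction hg using Subgroup.closure_induction with
  | mem g hg =>
    rcases hg with ⟨s, rfl⟩ | ⟨s, rfl⟩
    · by_cases h : IsPrefixOf s (const b)
      · obtain ⟨η, hη⟩ := h
        obtain rfl := (cat_eq_const.1 hη.symm).2
        conv_lhs => rw [hη]
        rw [D.hxx, x_const, ← hη]
      · exact D.hxx' _ _ h
    · by_cases h : IsPrefixOf s (const b)
      · obtain ⟨η, hη⟩ := h
        obtain rfl := (cat_eq_const.1 hη.symm).2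
        conv_lhs => rw [hη]
        rw [D.hyy, y_const, ← hη]
      · exact D.hyy' _ _ h
  | one => rfl
  | mul f g _ _ hf hg => rw [homeo_mul_apply, hg, hf]
  | inv f _ hf => rw [homeo_inv_apply, Homeomorph.symm_apply_eq, hf]

/-! ### Factoring elements of `Ŝ` -/

lemma yy_apply_of_disjoint {a b : List Bool} (hab : ∀ η ζ, cat a η ≠ cat b ζ) (ζ : Cantor) :
    D.yy a (cat b ζ) = cat b ζ :=
  D.hyy' _ _ fun ⟨η, h⟩ => hab η ζ h.symm

lemma yy_symm_apply_of_disjoint {a b : List Bool} (hab : ∀ η ζ, cat a η ≠ cat b ζ) (ζ : Cantor) :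
    (D.yy a).symm (cat b ζ) = cat b ζ := by
  rw [Homeomorph.symm_apply_eq, yy_apply_of_disjoint hab]

lemma yy_symm_apply (s : List Bool) (η : Cantor) :
    (D.yy s).symm (cat s η) = cat s (D.y.symm η) := by
  rw [Homeomorph.symm_apply_eq, D.hyy, Homeomorph.apply_symm_apply]

lemma yy_append_apply_of_not_isPrefixOf {s : List Bool} {ξ : Cantor} (h : ¬ IsPrefixOf s ξ)
    (t : List Bool) : D.yy (s ++ t) ξ = ξ :=
  D.hyy' _ _ fun ⟨η, hη⟩ => h ⟨_, hη.trans (cat_append s t η)⟩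

lemma cat_append_ne {s t t' : List Bool} (h : ∀ η ζ, cat t η ≠ cat t' ζ) (η ζ : Cantor) :
    cat (s ++ t) η ≠ cat (s ++ t') ζ := by
  simpa [cat_append] using h η ζ

variable (D) in
/-- The product `y_{s0} y_{s10}⁻¹ y_{s11}`. -/
def childProd (s : List Bool) : Cantor ≃ₜ Cantor :=
  D.yy (s ++ [true, true]) * ((D.yy (s ++ [true, false]))⁻¹ * D.yy (s ++ [false]))

lemma childProd_inv (s : List Bool) : (childProd D s)⁻¹ =
    (D.yy (s ++ [false]))⁻¹ * (D.yy (s ++ [true, false]) * (D.yy (s ++ [true, true]))⁻¹) := by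
  rw [childProd]; group

lemma yy_eq (s : List Bool) : D.yy s = childProd D s * D.xx s := by
  have d₁ := fun η ζ => cat_append_ne (s := s) (t := [false]) (t' := [true, false])
    (by simp [cat_cons_inj]) η ζ
  have d₂ := fun η ζ => cat_append_ne (s := s) (t := [false]) (t' := [true, true])
    (by simp [cat_cons_inj]) η ζ
  have d₃ := fun η ζ => cat_append_ne (s := s) (t := [true, false]) (t' := [true, true])
    (by simp [cat_cons_inj]) η ζ
  refine Homeomorph.ext fun ξ => ?_
  simp only [childProd, homeo_mul_apply, homeo_inv_apply]
  by_cases h : IsPrefixOf s ξ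
  · obtain ⟨η, rfl⟩ := h
    rw [D.hyy, D.hxx]
    obtain ⟨a, η, rfl⟩ := exists_eq_cat_singleton η
    cases a with
    | true =>
      rw [D.hy1, D.hx1, ← cat_append, ← cat_append, yy_apply_of_disjoint d₂,
        yy_symm_apply_of_disjoint d₃, D.hyy]
    | false =>
      obtain ⟨a, η, rfl⟩ := exists_eq_cat_singleton η
      rw [← cat_cons]
      cases a with
      | false =>
        rw [D.hy00, D.hx00, ← cat_append, ← cat_append, D.hyy,
          yy_symm_apply_of_disjoint fun η ζ => (d₁ ζ η).symm,
          yy_apply_of_disjoint fun η ζ => (d₂ ζ η).symm]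
      | true =>
        rw [D.hy01, D.hx01, ← cat_append, ← cat_append, yy_apply_of_disjoint d₁, yy_symm_apply,
          yy_apply_of_disjoint fun η ζ => (d₃ ζ η).symm]
  · rw [D.hyy' _ _ h, D.hxx' _ _ h, yy_append_apply_of_not_isPrefixOf h]
    rw [(Homeomorph.symm_apply_eq _).2 (yy_append_apply_of_not_isPrefixOf h _).symm,
      yy_append_apply_of_not_isPrefixOf h]

variable (D) in
/-- For every tree rotation `τ` sending `0^∞` to `α`, the product `h * τ` factors as a tree
rotation times an element of the Lodha–Moore group. -/
def FactorsAt (h : Cantor ≃ₜ Cantor) (α : Cantor) : Prop :=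
  ∀ τ, IsTreeRotation τ → τ (const false) = α →
    ∃ τ', IsTreeRotation τ' ∧ τ'⁻¹ * h * τ ∈ LMgrp D

lemma FactorsAt.mul {g h : Cantor ≃ₜ Cantor} {α : Cantor} (hg : FactorsAt D g (h α))
    (hh : FactorsAt D h α) : FactorsAt D (g * h) α := by
  intro τ hτ hα
  obtain ⟨σ, hσ, hσG⟩ := hh τ hτ hα
  have hσα : σ (const false) = h α := by
    have := LMgrp_apply_const hσG false
    rw [homeo_mul_apply, homeo_mul_apply, hα, homeo_inv_apply, Homeomorph.symm_apply_eq] at this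
    exact this.symm
  obtain ⟨ρ, hρ, hρG⟩ := hg σ hσ hσα
  refine ⟨ρ, hρ, ?_⟩
  have e : ρ⁻¹ * (g * h) * τ = (ρ⁻¹ * g * σ) * (σ⁻¹ * h * τ) := by group
  rw [e]
  exact mul_mem hρG hσG

lemma IsTreeRotation.factorsAt {g : Cantor ≃ₜ Cantor} (hg : IsTreeRotation g) (α : Cantor) :
    FactorsAt D g α := fun τ hτ _ => ⟨g * τ, hg.mul hτ, by
  have e : (g * τ)⁻¹ * g * τ = 1 := by group
  rw [e]; exact one_mem _⟩

lemma factorsAt_yy_of_notInterior {s : List Bool} {α : Cantor} (h : NotInterior s α) :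
    FactorsAt D (D.yy s) α := by
  rintro τ hτ rfl
  exact ⟨τ, hτ, conj_yy_mem_LMgrp hτ h⟩

lemma factorsAt_yy_inv_of_notInterior {s : List Bool} {α : Cantor} (h : NotInterior s α) :
    FactorsAt D (D.yy s)⁻¹ α := by
  rintro τ hτ rfl
  refine ⟨τ, hτ, ?_⟩
  have e : τ⁻¹ * (D.yy s)⁻¹ * τ = (τ⁻¹ * D.yy s * τ)⁻¹ := by group
  rw [e]
  exact inv_mem (conj_yy_mem_LMgrp hτ h)

lemma notInterior_of_disjoint {a b : List Bool} (hab : ∀ η ζ, cat a η ≠ cat b ζ) (ζ : Cantor) :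
    NotInterior a (cat b ζ) := fun η h => absurd h.symm (hab η ζ)

lemma factorsAt_childProd {v s : List Bool}
    (ih : ∀ t, FactorsAt D (D.yy t) (cat t (cat v (const false))) ∧
      FactorsAt D (D.yy t)⁻¹ (cat t (cat v (const false))))
    {t : List Bool} (ht : t ∈ [[false], [true, false], [true, true]]) :
    FactorsAt D (childProd D s) (cat (s ++ t) (cat v (const false))) ∧
      FactorsAt D (childProd D s)⁻¹ (cat (s ++ t) (cat v (const false))) := by
  have d₁ := fun η ζ => cat_append_ne (s := s) (t := [false]) (t' := [true, false])
    (by simp [cat_cons_inj]) η ζ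
  have d₂ := fun η ζ => cat_append_ne (s := s) (t := [false]) (t' := [true, true])
    (by simp [cat_cons_inj]) η ζ
  have d₃ := fun η ζ => cat_append_ne (s := s) (t := [true, false]) (t' := [true, true])
    (by simp [cat_cons_inj]) η ζ
  have d₁' := fun η ζ => (d₁ ζ η).symm
  have d₂' := fun η ζ => (d₂ ζ η).symm
  have d₃' := fun η ζ => (d₃ ζ η).symm
  have off {a b : List Bool} (hab : ∀ η ζ, cat a η ≠ cat b ζ) (ζ : Cantor) :
      FactorsAt D (D.yy a) (cat b ζ) :=
    factorsAt_yy_of_notInterior (notInterior_of_disjoint hab ζ)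
  have offInv {a b : List Bool} (hab : ∀ η ζ, cat a η ≠ cat b ζ) (ζ : Cantor) :
      FactorsAt D (D.yy a)⁻¹ (cat b ζ) :=
    factorsAt_yy_inv_of_notInterior (notInterior_of_disjoint hab ζ)
  rw [childProd_inv, childProd]
  simp only [mem_cons, not_mem_nil, or_false] at ht
  rcases ht with rfl | rfl | rfl
  · refine ⟨.mul ?_ (.mul ?_ (ih _).1), .mul ?_ (.mul ?_ (offInv d₂' _))⟩ <;>
      simp only [homeo_mul_apply, homeo_inv_apply, D.hyy, yy_apply_of_disjoint d₁',
        yy_symm_apply_of_disjoint d₁', yy_symm_apply_of_disjoint d₂']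
    exacts [off d₂' _, offInv d₁' _, (ih _).2, off d₁' _]
  · refine ⟨.mul ?_ (.mul ?_ (off d₁ _)), .mul ?_ (.mul ?_ (offInv d₃' _))⟩ <;>
      simp only [homeo_mul_apply, homeo_inv_apply, D.hyy, yy_symm_apply,
        yy_apply_of_disjoint d₁, yy_symm_apply_of_disjoint d₃']
    exacts [off d₃' _, (ih _).2, offInv d₁ _, (ih _).1]
  · refine ⟨.mul ?_ (.mul ?_ (off d₂ _)), .mul ?_ (.mul ?_ (ih _).2)⟩ <;>
      simp only [homeo_mul_apply, homeo_inv_apply, yy_symm_apply,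
        yy_apply_of_disjoint d₂, yy_apply_of_disjoint d₃, yy_symm_apply_of_disjoint d₃]
    exacts [(ih _).1, offInv d₃ _, offInv d₂ _, off d₃ _]

lemma factorsAt_yy_cat (w s : List Bool) :
    FactorsAt D (D.yy s) (cat s (cat w (const false))) ∧
      FactorsAt D (D.yy s)⁻¹ (cat s (cat w (const false))) := by
  induction hn : w.length using Nat.strong_induction_on generalizing w s with
  | _ n ih =>
  subst hn
  have base : NotInterior s (cat s (const false)) := fun η h => (cat_inj.1 h).symm
  have child {v t : List Bool} (hv : v.length < w.length)
      (ht : t ∈ [[false], [true, false], [true, true]]) :=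
    factorsAt_childProd (s := s) (fun t => ih v.length hv v t rfl) ht
  have fwd {v : List Bool} (t : List Bool) (hv : v.length < w.length)
      (ht : t ∈ [[false], [true, false], [true, true]])
      (e : D.x (cat w (const false)) = cat t (cat v (const false))) :
      FactorsAt D (D.yy s) (cat s (cat w (const false))) := by
    rw [yy_eq s]
    refine .mul ?_ ((isTreeRotation_xx s).factorsAt _)
    rw [D.hxx, e, ← cat_append]
    exact (child hv ht).1
  have bwd {v : List Bool} (t : List Bool) (hv : v.length < w.length)
      (ht : t ∈ [[false], [true, false], [true, true]])
      (e : cat w (const false) = cat t (cat v (const false))) :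
      FactorsAt D (D.yy s)⁻¹ (cat s (cat w (const false))) := by
    rw [yy_eq s, mul_inv_rev]
    refine .mul ((isTreeRotation_xx s).inv.factorsAt _) ?_
    rw [e, ← cat_append]
    exact (child hv ht).2
  rcases w with _ | ⟨_ | _, w⟩
  · rw [cat_nil]
    exact ⟨factorsAt_yy_of_notInterior base, factorsAt_yy_inv_of_notInterior base⟩
  · refine ⟨?_, bwd [false] (v := w) (by simp) (by simp) (cat_cons _ _ _)⟩
    rcases w with _ | ⟨_ | _, w⟩
    · rw [cat_const]
      exact factorsAt_yy_of_notInterior base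
    · exact fwd [false] (v := w) (by simp) (by simp) (by rw [← D.hx00, ← cat_append]; rfl)
    · exact fwd [true, false] (v := w) (by simp) (by simp) (by rw [← D.hx01, ← cat_append]; rfl)
  · refine ⟨fwd [true, true] (v := w) (by simp) (by simp) (by rw [← D.hx1, ← cat_append]; rfl), ?_⟩
    rcases w with _ | ⟨_ | _, w⟩
    · exact bwd [true, false] (v := []) (by simp) (by simp)
        (by rw [cat_nil, cat_cons true [false], cat_const])
    · exact bwd [true, false] (v := w) (by simp) (by simp) (by rw [← cat_append]; rfl)
    · exact bwd [true, true] (v := w) (by simp) (by simp) (by rw [← cat_append]; rfl)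

lemma factorsAt_yy (s : List Bool) (α : Cantor) :
    FactorsAt D (D.yy s) α ∧ FactorsAt D (D.yy s)⁻¹ α := by
  by_cases h : IsPrefixOf s α
  · obtain ⟨η, rfl⟩ := h
    suffices ∀ τ, IsTreeRotation τ → τ (const false) = cat s η → ∃ w, η = cat w (const false) by
      constructor
      all_goals
        intro τ hτ hα
        obtain ⟨w, rfl⟩ := this τ hτ hα
      exacts [(factorsAt_yy_cat w s).1 τ hτ hα, (factorsAt_yy_cat w s).2 τ hτ hα]
    intro τ hτ hα
    obtain ⟨w, hw⟩ := hτ.exists_apply_const_eq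
    exact exists_eq_cat_of_cat_eq (hw.symm.trans hα).symm
  · have h' : NotInterior s α := fun η hη => absurd ⟨η, hη⟩ h
    exact ⟨factorsAt_yy_of_notInterior h', factorsAt_yy_inv_of_notInterior h'⟩

lemma factorsAt_of_mem_Shat {h : Cantor ≃ₜ Cantor} (hh : h ∈ Shat D) (α : Cantor) :
    FactorsAt D h α := by
  suffices (∀ α, FactorsAt D h α) ∧ ∀ α, FactorsAt D h⁻¹ α from this.1 α
  induction hh using Subgroup.closure_induction with
  | mem h hh =>
    rcases hh with (⟨s, rfl⟩ | ⟨s, rfl⟩) | ⟨n, rfl⟩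
    · exact ⟨(isTreeRotation_xx s).factorsAt, (isTreeRotation_xx s).inv.factorsAt⟩
    · exact ⟨fun α => (factorsAt_yy s α).1, fun α => (factorsAt_yy s α).2⟩
    · exact ⟨(isTreeRotation_p n).factorsAt, (isTreeRotation_p n).inv.factorsAt⟩
  | one => exact ⟨IsTreeRotation.one.factorsAt, IsTreeRotation.one.inv.factorsAt⟩
  | mul f g _ _ hf hg =>
    exact ⟨fun α => (hf.1 _).mul (hg.1 α), fun α => mul_inv_rev f g ▸ (hg.2 _).mul (hf.2 α)⟩
  | inv f _ hf => exact ⟨hf.2, by simpa using hf.1⟩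

lemma mem_LMgrp_of_mem_Shat {g : Cantor ≃ₜ Cantor} (hg : g ∈ Shat D)
    (h₀ : g (const false) = const false) : g ∈ LMgrp D := by
  obtain ⟨τ, hτ, h⟩ := factorsAt_of_mem_Shat hg (const false) 1 .one rfl
  rw [mul_one] at h
  have hτ₀ : τ (const false) = const false := by
    have := LMgrp_apply_const h false
    rw [homeo_mul_apply, h₀, homeo_inv_apply, Homeomorph.symm_apply_eq] at this
    exact this.symm
  simpa using mul_mem (hτ.mem_LMgrp (D := D) hτ₀) h

end Main

end LodhaMoore

/-- the elements of `Ŝ` fixing both constant sequences `0^∞` and `1^∞`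
form exactly the Lodha–Moore group `_yG_y`. -/
theorem statement9 (D : LMData) :
    {g : Cantor ≃ₜ Cantor | g ∈ Shat D ∧
        g (fun _ => false) = (fun _ => false) ∧ g (fun _ => true) = (fun _ => true)} =
      ↑(LMgrp D) := by
  ext g
  refine ⟨fun ⟨hg, h₀, _⟩ => LodhaMoore.mem_LMgrp_of_mem_Shat hg h₀, fun hg =>
    ⟨Subgroup.closure_mono Set.subset_union_left hg, LodhaMoore.LMgrp_apply_const hg false,
      LodhaMoore.LMgrp_apply_const hg true⟩⟩
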